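/- If the controlled system (CSDE) is (open loop) stabilizable in probability at the origin, then the origin is a controlled equilibrium: there exists ᾱ ∈ A such that f(0,ᾱ) = 0 and σ(0,ᾱ) = 0. -/

import Mathlib

open MeasureTheory Filter Set
open scoped InnerProductSpace ENNReal NNReal Topology

noncomputable section

/-- Euclidean space `ℝ^N`. -/
abbrev EN (N : ℕ) := EuclideanSpace ℝ (Fin N)

/-- Frobenius norm of an `N × M` real matrix. -/
def mnorm {N M : ℕ} (σ : Matrix (Fin N) (Fin M) ℝ) : ℝ :=
  Real.sqrt (∑ i, ∑ j, (σ i j) ^ 2)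

/-- Entry `(i,j)` of the Hessian `D²φ(x)`. -/
def hessEntry {N : ℕ} (φ : EN N → ℝ) (x : EN N) (i j : Fin N) : ℝ :=
  iteratedFDeriv ℝ 2 φ x ![EuclideanSpace.single i 1, EuclideanSpace.single j 1]

/-- `trace (a · D²φ(x))` for a square matrix `a`. -/
def traceTerm {N : ℕ} (a : Matrix (Fin N) (Fin N) ℝ) (φ : EN N → ℝ) (x : EN N) : ℝ :=
  ∑ i, ∑ j, a i j * hessEntry φ x j i

/-- The generator `L^α φ(x) = f(x,α)·Dφ(x) + trace(a(x,α) D²φ(x))`. -/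
def gen {N M : ℕ} (f : EN N → EN M → EN N)
    (a : EN N → EN M → Matrix (Fin N) (Fin N) ℝ)
    (φ : EN N → ℝ) (x : EN N) (α : EN M) : ℝ :=
  ⟪f x α, gradient φ x⟫_ℝ + traceTerm (a x α) φ x

/-- Lipschitz-in-`x` condition on the coefficients, uniformly over `α ∈ A`. -/
def LipCoeff {N M : ℕ} (A : Set (EN M)) (f : EN N → EN M → EN N)
    (σ : EN N → EN M → Matrix (Fin N) (Fin M) ℝ) : Prop :=
  ∃ C : ℝ, ∀ α ∈ A, ∀ x y : EN N,
    ‖f x α - f y α‖ + mnorm (σ x α - σ y α) ≤ C * ‖x - y‖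

/-- Convexity of the set `{(a(x,α), f(x,α)) : α ∈ A}` for every `x`. -/
def ConvexCoeff {N M : ℕ} (A : Set (EN M)) (f : EN N → EN M → EN N)
    (a : EN N → EN M → Matrix (Fin N) (Fin N) ℝ) : Prop :=
  ∀ x : EN N, Convex ℝ {p : Matrix (Fin N) (Fin N) ℝ × EN N | ∃ α ∈ A, p = (a x α, f x α)}

/-- Viscosity supersolution of `max_{α∈A} { -f(x,α)·DV(x) - tr(a(x,α) D²V(x)) } = g(x)` on `O`:
at every local minimum point `x₀ ∈ O` of `V - φ` (relative to `O`), with `φ` of class `C²`,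
one has `max_{α∈A} { -f(x₀,α)·Dφ(x₀) - tr(a(x₀,α) D²φ(x₀)) } ≥ g(x₀)` (the maximum over the
compact set `A` being attained, this is expressed by an existential quantifier). -/
def IsSupersolution {N M : ℕ} (A : Set (EN M)) (f : EN N → EN M → EN N)
    (a : EN N → EN M → Matrix (Fin N) (Fin N) ℝ)
    (O : Set (EN N)) (g : EN N → ℝ) (V : EN N → ℝ) : Prop :=
  ∀ φ : EN N → ℝ, ContDiff ℝ 2 φ → ∀ x₀ ∈ O,
    IsLocalMinOn (fun y => V y - φ y) O x₀ →
    ∃ α ∈ A, g x₀ ≤ -gen f a φ x₀ α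

/-- Viscosity subsolution of `max_{α∈A} { -f(x,α)·DU(x) - tr(a(x,α) D²U(x)) } = g(x)` on `O`. -/
def IsSubsolution {N M : ℕ} (A : Set (EN M)) (f : EN N → EN M → EN N)
    (a : EN N → EN M → Matrix (Fin N) (Fin N) ℝ)
    (O : Set (EN N)) (g : EN N → ℝ) (U : EN N → ℝ) : Prop :=
  ∀ φ : EN N → ℝ, ContDiff ℝ 2 φ → ∀ x₀ ∈ O,
    IsLocalMaxOn (fun y => U y - φ y) O x₀ →
    ∀ α ∈ A, -gen f a φ x₀ α ≤ g x₀

/-- An admissible (weak) control for the initial point `x`: a filtered probability space,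
a continuous progressively measurable process `X` with `X 0 = x` a.s., and a progressively
measurable `A`-valued control process `α`, such that for every bounded `C²` test function `φ`
the process `φ(X_t) - ∫₀ᵗ [f(X_s,α_s)·Dφ(X_s) + tr(a(X_s,α_s) D²φ(X_s))] ds` is a
`P`-martingale (integrable, adapted by progressive measurability of `X` and `α`, and
satisfying the conditional-expectation identity for all `0 ≤ s ≤ t`). -/
structure Control (N M : ℕ) (A : Set (EN M)) (f : EN N → EN M → EN N)
    (a : EN N → EN M → Matrix (Fin N) (Fin N) ℝ) (x : EN N) where
  (Ω : Type)
  [mΩ : MeasurableSpace Ω]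
  (P : Measure Ω)
  [isProb : IsProbabilityMeasure P]
  (F : Filtration ℝ mΩ)
  (X : ℝ → Ω → EN N)
  (α : ℝ → Ω → EN M)
  (X_cont : ∀ ω, Continuous fun t => X t ω)
  (X_prog : ProgMeasurable F X)
  (α_prog : ProgMeasurable F α)
  (α_mem : ∀ t ω, α t ω ∈ A)
  (init : ∀ᵐ ω ∂P, X 0 ω = x)
  (mart_int : ∀ φ : EN N → ℝ, ContDiff ℝ 2 φ → (∃ K, ∀ y, |φ y| ≤ K) →
    ∀ t : ℝ, 0 ≤ t → Integrable
      (fun ω => φ (X t ω) - ∫ s in Ioc (0:ℝ) t, gen f a φ (X s ω) (α s ω)) P)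
  (mart : ∀ φ : EN N → ℝ, ContDiff ℝ 2 φ → (∃ K, ∀ y, |φ y| ≤ K) →
    ∀ s t : ℝ, 0 ≤ s → s ≤ t →
      P[fun ω => φ (X t ω) - ∫ u in Ioc (0:ℝ) t, gen f a φ (X u ω) (α u ω) | F s]
        =ᵐ[P] fun ω => φ (X s ω) - ∫ u in Ioc (0:ℝ) s, gen f a φ (X u ω) (α u ω))

/-- Expected payoff `E_x[ V(X_t) + ∫₀ᵗ l(X_s) ds ]` for a control `c` at time `t ≥ 0`. -/
def payoff {N M : ℕ} {A : Set (EN M)} {f : EN N → EN M → EN N}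
    {a : EN N → EN M → Matrix (Fin N) (Fin N) ℝ} {x : EN N}
    (c : Control N M A f a x) (V l : EN N → ℝ) (t : ℝ) : ℝ :=
  ∫ ω, (V (c.X t ω) + ∫ s in Ioc (0:ℝ) t, l (c.X s ω)) ∂c.P

/-- Quadratic function with prescribed bilinear form: derivatives. -/
lemma aux_quad0 {E : Type*} [NormedAddCommGroup E] [NormedSpace ℝ E]
    (l : E →L[ℝ] ℝ) (B : E →L[ℝ] E →L[ℝ] ℝ) :
    ContDiff ℝ 2 (fun x => l x + 2⁻¹ * B x x) ∧
    fderiv ℝ (fun x => l x + 2⁻¹ * B x x) 0 = l ∧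
    ∀ v w, fderiv ℝ (fderiv ℝ (fun x => l x + 2⁻¹ * B x x)) 0 v w = 2⁻¹ * (B v w + B w v) := by
  have hq : ∀ x, HasFDerivAt (fun x => l x + 2⁻¹ * B x x)
      (l + (2⁻¹ : ℝ) • (B x + B.flip x)) x := by
    intro x
    have h1 := (B.hasFDerivAt (x := x)).clm_apply (hasFDerivAt_id x)
    have h2 := (l.hasFDerivAt (x := x)).add (h1.const_mul (2⁻¹ : ℝ))
    exact h2
  have hfd : fderiv ℝ (fun x => l x + 2⁻¹ * B x x) =
      fun x => l + (2⁻¹ : ℝ) • (B x + B.flip x) :=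
    funext fun x => (hq x).fderiv
  have hqc : ContDiff ℝ 2 (fun x => l x + 2⁻¹ * B x x) := by
    have : ContDiff ℝ 2 (fun x => B x x) := B.contDiff.clm_apply contDiff_id
    exact l.contDiff.add (contDiff_const.mul this)
  refine ⟨hqc, by rw [hfd]; simp, fun v w => ?_⟩
  rw [hfd]
  have : HasFDerivAt (fun x => l + ((2⁻¹ : ℝ) • (B + B.flip)) x) ((2⁻¹ : ℝ) • (B + B.flip)) 0 :=
    (((2⁻¹ : ℝ) • (B + B.flip)).hasFDerivAt (x := 0)).const_add l
  have h2 : fderiv ℝ (fun x => l + (2⁻¹ : ℝ) • (B x + B.flip x)) 0 = (2⁻¹ : ℝ) • (B + B.flip) :=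
    this.fderiv
  rw [h2]
  simp
  ring

/-- Compactly supported function with prescribed first and second derivatives at the origin. -/
lemma aux_quad {N : ℕ} (l : EN N →L[ℝ] ℝ) (B : EN N →L[ℝ] EN N →L[ℝ] ℝ) :
    ∃ φ : EN N → ℝ, ContDiff ℝ 2 φ ∧ HasCompactSupport φ ∧ fderiv ℝ φ 0 = l ∧
      ∀ i j, hessEntry φ 0 i j = 2⁻¹ * (B (EuclideanSpace.single i 1) (EuclideanSpace.single j 1)
        + B (EuclideanSpace.single j 1) (EuclideanSpace.single i 1)) := by
  obtain ⟨hqc, hfd, hfd2⟩ := aux_quad0 l B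
  set q : EN N → ℝ := fun x => l x + 2⁻¹ * B x x
  let ψ : ContDiffBump (0 : EN N) := ⟨1, 2, one_pos, one_lt_two⟩
  have hev : (fun x => ψ x * q x) =ᶠ[𝓝 0] q := by
    filter_upwards [ψ.eventuallyEq_one] with x hx
    simp [hx]
  refine ⟨fun x => ψ x * q x, ψ.contDiff.mul hqc, ψ.hasCompactSupport.mul_right, ?_, ?_⟩
  · rw [hev.fderiv_eq, hfd]
  · intro i j
    unfold hessEntry
    rw [(hev.iteratedFDeriv ℝ 2).self_of_nhds, iteratedFDeriv_two_apply, hfd2]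
    rfl

/-- Sections of progressively measurable processes. -/
lemma aux_sec {Ω E : Type*} [mΩ : MeasurableSpace Ω] [NormedAddCommGroup E] [MeasurableSpace E]
    [BorelSpace E] (F : Filtration ℝ mΩ) (X : ℝ → Ω → E) (h : IsStronglyProgressive F X)
    (t : ℝ) (ω : Ω) : Measurable (fun s : Iic t => X s ω) := by
  have h1 := h t
  generalize F t = m at h1
  exact h1.measurable.comp (@measurable_prodMk_right _ _ _ m ω)

/-- Marginals of progressively measurable processes. -/
lemma aux_marg {Ω E : Type*} [mΩ : MeasurableSpace Ω] [NormedAddCommGroup E] [MeasurableSpace E]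
    [BorelSpace E] (F : Filtration ℝ mΩ) (X : ℝ → Ω → E) (h : IsStronglyProgressive F X)
    (t : ℝ) : Measurable (X t) :=
  ((h.stronglyAdapted t).measurable).mono (F.le t) le_rfl

/-- Time integrability of the generator. -/
lemma aux_time {N M : ℕ} (A : Set (EN M)) (G : EN N → EN M → ℝ)
    (hcont : Continuous (fun p : EN N × A => G p.1 p.2))
    (K : ℝ) (hK : ∀ x, ∀ α ∈ A, |G x α| ≤ K) (t : ℝ) (X : ℝ → EN N) (α : ℝ → EN M)
    (hα : ∀ s, α s ∈ A) (h1 : Measurable (fun s : Iic t => X s))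
    (h2 : Measurable (fun s : Iic t => α s)) :
    IntegrableOn (fun s => G (X s) (α s)) (Ioc 0 t) := by
  have hm : Measurable (fun s : Iic t => G (X s) (α s)) := by
    have h3 : Measurable (fun s : Iic t => (⟨α s, hα _⟩ : A)) := h2.subtype_mk
    exact hcont.measurable.comp (h1.prodMk h3)
  have hm2 : AEMeasurable (fun s => G (X s) (α s)) (volume.restrict (Iic t)) :=
    aemeasurable_restrict_of_measurable_subtype measurableSet_Iic hm
  have hm3 := hm2.mono_measure (Measure.restrict_mono (Ioc_subset_Iic_self (a := 0)) le_rfl)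
  exact Integrable.of_bound (C := K) hm3.aestronglyMeasurable
    (Eventually.of_forall fun s => hK _ _ (hα _))

/-- The generator is jointly continuous. -/
lemma aux_cont {N M : ℕ} (A : Set (EN M))
    (f : EN N → EN M → EN N) (σ : EN N → EN M → Matrix (Fin N) (Fin M) ℝ)
    (hf : ContinuousOn (fun p : EN N × EN M => f p.1 p.2) (univ ×ˢ A))
    (hσ : ContinuousOn (fun p : EN N × EN M => σ p.1 p.2) (univ ×ˢ A))
    (a : EN N → EN M → Matrix (Fin N) (Fin N) ℝ)
    (ha : ∀ y β, a y β = (2⁻¹ : ℝ) • (σ y β * (σ y β).transpose))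
    (φ : EN N → ℝ) (hφ : ContDiff ℝ 2 φ) :
    Continuous (fun p : EN N × A => gen f a φ p.1 p.2) := by
  have hi : Continuous (fun p : EN N × A => ((p.1, (p.2 : EN M)) : EN N × EN M)) := by fun_prop
  have hf' : Continuous (fun p : EN N × A => f p.1 p.2) :=
    hf.comp_continuous hi (fun p => ⟨mem_univ _, p.2.2⟩)
  have hσ' : Continuous (fun p : EN N × A => σ p.1 p.2) :=
    hσ.comp_continuous hi (fun p => ⟨mem_univ _, p.2.2⟩)
  have ha' : Continuous (fun p : EN N × A => a p.1 p.2) := by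
    simp only [ha]
    exact (hσ'.matrix_mul hσ'.matrix_transpose).const_smul (2⁻¹ : ℝ)
  have hg : Continuous (gradient φ) :=
    (InnerProductSpace.toDual ℝ (EN N)).symm.continuous.comp (hφ.continuous_fderiv (by norm_num))
  have hh : ∀ i j, Continuous (fun x => hessEntry φ x i j) := by
    intro i j
    have h0 : Continuous (iteratedFDeriv ℝ 2 φ) := hφ.continuous_iteratedFDeriv (by norm_num)
    exact (ContinuousMultilinearMap.apply ℝ (fun _ : Fin 2 => EN N) ℝ
      ![EuclideanSpace.single i 1, EuclideanSpace.single j 1]).continuous.comp h0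
  unfold gen traceTerm
  refine (hf'.inner (hg.comp continuous_fst)).add ?_
  refine continuous_finsetSum _ fun i _ => continuous_finsetSum _ fun j _ => ?_
  exact (ha'.matrix_elem i j).mul ((hh j i).comp continuous_fst)

/-- The generator applied to a compactly supported function is bounded. -/
lemma aux_bdd {N M : ℕ} (A : Set (EN M)) (hA : IsCompact A)
    (f : EN N → EN M → EN N)
    (a : EN N → EN M → Matrix (Fin N) (Fin N) ℝ)
    (φ : EN N → ℝ) (hc : HasCompactSupport φ)
    (hcont : Continuous (fun p : EN N × A => gen f a φ p.1 p.2)) :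
    ∃ K, 0 ≤ K ∧ ∀ x, ∀ α ∈ A, |gen f a φ x α| ≤ K := by
  have : CompactSpace A := isCompact_iff_compactSpace.mp hA
  have hK : IsCompact ((tsupport φ) ×ˢ (univ : Set A)) := hc.isCompact.prod isCompact_univ
  obtain ⟨K, hK⟩ := hK.exists_bound_of_continuousOn hcont.continuousOn
  refine ⟨max K 0, le_max_right _ _, fun x α hα => ?_⟩
  by_cases hx : x ∈ tsupport φ
  · exact (hK (x, ⟨α, hα⟩) ⟨hx, mem_univ _⟩).trans (le_max_left _ _)
  · have h1 : fderiv ℝ φ x = 0 := fderiv_of_notMem_tsupport ℝ hx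
    have h2 : iteratedFDeriv ℝ 2 φ x = 0 := by
      by_contra h
      exact hx (support_iteratedFDeriv_subset (𝕜 := ℝ) 2 h)
    simp [gen, traceTerm, hessEntry, gradient, h1, h2]

/-- Main probabilistic estimate. -/
lemma aux_prob {N M : ℕ} (A : Set (EN M))
    (f : EN N → EN M → EN N)
    (a : EN N → EN M → Matrix (Fin N) (Fin N) ℝ)
    (φ : EN N → ℝ) (hφ : ContDiff ℝ 2 φ) (D : ℝ) (hD : ∀ y, |φ y| ≤ D)
    (hcont : Continuous (fun p : EN N × A => gen f a φ p.1 p.2))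
    (K : ℝ) (hK0 : 0 ≤ K) (hK : ∀ x, ∀ α ∈ A, |gen f a φ x α| ≤ K)
    (u r : ℝ) (hu : 0 < u) (hr : 0 < r) (hpos : ∀ x, ‖x‖ < r → ∀ α ∈ A, u ≤ gen f a φ x α)
    (ε : ℝ) (hε : 0 ≤ ε) (x : EN N) (c : Control N M A f a x)
    (hc : c.P {ω | ENNReal.ofReal r ≤ ⨆ t : Ici (0:ℝ), (‖c.X (t : ℝ) ω‖₊ : ℝ≥0∞)}
          ≤ ENNReal.ofReal ε) (t : ℝ) (ht : 0 ≤ t) :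
    t * (u - (u + K) * ε) ≤ 2 * D := by
  obtain ⟨Ω, P, F, X, α, X_cont, X_prog, α_prog, α_mem, init, mart_int, mart⟩ := c
  rename_i mΩ isProb
  dsimp only at hc
  set S := {ω | ENNReal.ofReal r ≤ ⨆ t : Ici (0:ℝ), (‖X (t : ℝ) ω‖₊ : ℝ≥0∞)} with hS
  set T := toMeasurable P S with hT
  have hTm : MeasurableSet T := measurableSet_toMeasurable _ _
  have hTP : P.real T ≤ ε := by
    rw [Measure.real, hT, measure_toMeasurable]
    exact ENNReal.toReal_le_of_le_ofReal hε hc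
  have hb : ∃ K, ∀ y, |φ y| ≤ K := ⟨D, hD⟩
  set I : Ω → ℝ := fun ω => ∫ s in Ioc (0:ℝ) t, gen f a φ (X s ω) (α s ω) with hI
  have hXt : Measurable (X t) := aux_marg F X X_prog t
  have hφi : Integrable (fun ω => φ (X t ω)) P := by
    refine Integrable.of_bound (C := D) ?_ ?_
    · exact (hφ.continuous.measurable.comp hXt).aestronglyMeasurable
    · exact Eventually.of_forall fun ω => hD _
  have hIi : Integrable I P := by
    have := hφi.sub (mart_int φ hφ hb t ht)
    refine this.congr (Eventually.of_forall fun ω => ?_)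
    simp [hI]
  have hexp : ∫ ω, (φ (X t ω) - I ω) ∂P = φ x := by
    rw [← integral_condExp (F.le 0), integral_congr_ae (mart φ hφ hb 0 t le_rfl ht)]
    have : (fun ω => φ (X 0 ω) - ∫ u in Ioc (0:ℝ) 0, gen f a φ (X u ω) (α u ω))
        =ᵐ[P] fun _ => φ x := by
      filter_upwards [init] with ω h
      simp [h]
    rw [integral_congr_ae this]
    simp
  rw [integral_sub hφi hIi] at hexp
  have hle1 : ∫ ω, φ (X t ω) ∂P ≤ D := by
    calc ∫ ω, φ (X t ω) ∂P ≤ ∫ ω, D ∂P :=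
          integral_mono hφi (integrable_const _) fun ω => (abs_le.mp (hD _)).2
      _ = D := by simp
  have hle2 : -D ≤ φ x := (abs_le.mp (hD x)).1
  -- integrability in time
  have hint : ∀ ω, IntegrableOn (fun s => gen f a φ (X s ω) (α s ω)) (Ioc 0 t) := by
    intro ω
    exact aux_time A (gen f a φ) hcont K hK t (fun s => X s ω) (fun s => α s ω)
      (fun s => α_mem s ω) (aux_sec F X X_prog t ω) (aux_sec F α α_prog t ω)
  have hconst : ∀ v : ℝ, ∫ _ in Ioc (0:ℝ) t, v = t * v := by
    intro v; simp [ht]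
  have hIlow : ∀ ω, t * u - T.indicator (fun _ => t * (u + K)) ω ≤ I ω := by
    intro ω
    by_cases hω : ω ∈ T
    · rw [indicator_of_mem hω]
      have : t * (-K) ≤ I ω := by
        rw [← hconst]
        exact setIntegral_mono (by simp) (hint ω) fun s => (abs_le.mp (hK _ _ (α_mem _ _))).1
      linarith
    · rw [indicator_of_notMem hω, sub_zero, ← hconst]
      have hω' : ω ∉ S := fun h => hω (subset_toMeasurable _ _ h)
      refine setIntegral_mono_on (by simp) (hint ω) measurableSet_Ioc fun s hs => ?_
      refine hpos _ ?_ _ (α_mem _ _)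
      simp only [hS, mem_setOf_eq, not_le] at hω'
      have h1 := (le_iSup (fun t : Ici (0:ℝ) => (‖X (t : ℝ) ω‖₊ : ℝ≥0∞)) ⟨s, hs.1.le⟩).trans_lt hω'
      rw [ENNReal.ofReal, ENNReal.coe_lt_coe, Real.lt_toNNReal_iff_coe_lt] at h1
      exact h1
  have hint2 : Integrable (T.indicator (fun _ => t * (u + K))) P :=
    (integrable_const _).indicator hTm
  have hfin : t * u - P.real T * (t * (u + K)) ≤ ∫ ω, I ω ∂P := by
    have := integral_mono ((integrable_const (t * u)).sub hint2) hIi hIlow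
    rw [integral_sub' (integrable_const _) hint2, integral_indicator_const _ hTm] at this
    simpa using this
  have : P.real T * (t * (u + K)) ≤ ε * (t * (u + K)) :=
    mul_le_mul_of_nonneg_right hTP (by positivity)
  nlinarith

/-- Remark 4.2: if (CSDE) is open-loop stabilizable in probability at the
origin, then the origin is a controlled equilibrium. -/
theorem stmt6 {N M : ℕ} (hN : 1 ≤ N) (hM : 1 ≤ M)
    (A : Set (EN M)) (hA : IsCompact A)
    (f : EN N → EN M → EN N) (σ : EN N → EN M → Matrix (Fin N) (Fin M) ℝ)
    (hf : ContinuousOn (fun p : EN N × EN M => f p.1 p.2) (univ ×ˢ A))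
    (hσ : ContinuousOn (fun p : EN N × EN M => σ p.1 p.2) (univ ×ˢ A))
    (hlip : LipCoeff A f σ)
    (a : EN N → EN M → Matrix (Fin N) (Fin N) ℝ)
    (ha : ∀ y β, a y β = (2⁻¹ : ℝ) • (σ y β * (σ y β).transpose))
    (hconv : ConvexCoeff A f a)
    (hstab : ∀ ε > (0:ℝ), ∀ k > (0:ℝ), ∃ δ > (0:ℝ), ∀ x : EN N, ‖x‖ ≤ δ →
      ∃ c : Control N M A f a x,
        c.P {ω | ENNReal.ofReal k ≤ ⨆ t : Ici (0:ℝ), (‖c.X (t : ℝ) ω‖₊ : ℝ≥0∞)}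
          ≤ ENNReal.ofReal ε) :
    ∃ αb ∈ A, f 0 αb = 0 ∧ σ 0 αb = 0 := by
  by_contra hno
  push Not at hno
  have : CompactSpace A := isCompact_iff_compactSpace.mp hA
  have : LocallyConvexSpace ℝ (Matrix (Fin N) (Fin N) ℝ) :=
    inferInstanceAs (LocallyConvexSpace ℝ (Fin N → Fin N → ℝ))
  set Q := {p : Matrix (Fin N) (Fin N) ℝ × EN N | ∃ α ∈ A, p = (a 0 α, f 0 α)} with hQ
  have hQc : IsClosed Q := by
    have hi : Continuous (fun p : A => (((0 : EN N), (p : EN M)) : EN N × EN M)) := by fun_prop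
    have hf' : Continuous (fun p : A => f 0 p) :=
      hf.comp_continuous hi (fun p => ⟨mem_univ _, p.2⟩)
    have hσ' : Continuous (fun p : A => σ 0 p) :=
      hσ.comp_continuous hi (fun p => ⟨mem_univ _, p.2⟩)
    have ha' : Continuous (fun p : A => a 0 p) := by
      simp only [ha]
      exact (hσ'.matrix_mul hσ'.matrix_transpose).const_smul (2⁻¹ : ℝ)
    have : Q = range (fun p : A => (a 0 p, f 0 p)) := by
      ext p
      simp [hQ, eq_comm]
    rw [this]
    exact (isCompact_range (ha'.prodMk hf')).isClosed
  have h0 : (0 : Matrix (Fin N) (Fin N) ℝ × EN N) ∉ Q := by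
    rintro ⟨α, hα, h⟩
    obtain ⟨h1, h2⟩ := Prod.mk.inj h
    refine hno α hα h2.symm ?_
    rw [ha] at h1
    have h3 : σ 0 α * (σ 0 α).transpose = 0 := by
      have := h1.symm
      simpa using this
    rw [← Matrix.self_mul_conjTranspose_eq_zero, Matrix.conjTranspose_eq_transpose_of_trivial]
    exact h3
  obtain ⟨L, u, hu0, hu⟩ := geometric_hahn_banach_point_closed (hconv 0) hQc h0
  rw [map_zero] at hu0
  let l : EN N →L[ℝ] ℝ := L.comp (ContinuousLinearMap.inr ℝ _ _)
  let B : EN N →L[ℝ] EN N →L[ℝ] ℝ := ∑ i, ∑ j, L (Matrix.single i j 1, 0) •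
    (EuclideanSpace.proj i : EN N →L[ℝ] ℝ).smulRight (EuclideanSpace.proj j : EN N →L[ℝ] ℝ)
  have hB : ∀ i j, B (EuclideanSpace.single i 1) (EuclideanSpace.single j 1)
      = L (Matrix.single i j 1, 0) := by
    intro i j
    simp [B, PiLp.single_apply]
  obtain ⟨φ, hφ, hφc, hφ1, hφ2⟩ := aux_quad l B
  have hgen0 : ∀ α, gen f a φ 0 α = L (a 0 α, f 0 α) := by
    intro α
    have hsym : ∀ i j, a 0 α i j = a 0 α j i := by
      intro i j
      simp [ha, Matrix.mul_apply, mul_comm]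
    have e1 : L (a 0 α, f 0 α) = L (a 0 α, 0) + L (0, f 0 α) := by
      rw [← map_add]; simp
    have e2 : L (a 0 α, 0) = ∑ i, ∑ j, a 0 α i j * L (Matrix.single i j 1, 0) := by
      have : L (a 0 α, 0) = (L.comp (ContinuousLinearMap.inl ℝ _ _)) (a 0 α) := rfl
      rw [this]
      conv_lhs => rw [Matrix.matrix_eq_sum_single (a 0 α)]
      rw [map_sum]
      refine Finset.sum_congr rfl fun i _ => ?_
      rw [map_sum]
      refine Finset.sum_congr rfl fun j _ => ?_
      have : Matrix.single i j (a 0 α i j) = a 0 α i j • Matrix.single i j (1:ℝ) := by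
        simp [Matrix.smul_single]
      rw [this, map_smul]
      rfl
    have e3 : ∑ i, ∑ j, a 0 α i j * L (Matrix.single j i 1, 0)
        = ∑ i, ∑ j, a 0 α i j * L (Matrix.single i j 1, 0) := by
      rw [Finset.sum_comm]
      refine Finset.sum_congr rfl fun i _ => Finset.sum_congr rfl fun j _ => ?_
      rw [hsym]
    have e4 : ⟪f 0 α, gradient φ 0⟫_ℝ = L (0, f 0 α) := by
      rw [real_inner_comm, gradient, InnerProductSpace.toDual_symm_apply, hφ1]
      rfl
    have e5 : traceTerm (a 0 α) φ 0 = L (a 0 α, 0) := by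
      unfold traceTerm
      simp only [hφ2, hB]
      have : ∀ i j, a 0 α i j * (2⁻¹ * (L (Matrix.single j i 1, 0) + L (Matrix.single i j 1, 0)))
        = 2⁻¹ * (a 0 α i j * L (Matrix.single j i 1, 0))
          + 2⁻¹ * (a 0 α i j * L (Matrix.single i j 1, 0)) := fun i j => by ring
      simp only [this, Finset.sum_add_distrib, ← Finset.mul_sum]
      rw [e3, e2]
      ring
    rw [gen, e4, e5, e1, add_comm]
  have hcont := aux_cont A f σ hf hσ a ha φ hφ
  obtain ⟨K, hK0, hK⟩ := aux_bdd A hA f a φ hφc hcont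
  obtain ⟨D, hD⟩ := hφc.exists_bound_of_continuous hφ.continuous
  have hev : ∀ᶠ x in 𝓝 (0 : EN N), ∀ β ∈ (univ : Set A), u < gen f a φ x β := by
    refine isCompact_univ.eventually_forall_of_forall_eventually fun β _ => ?_
    refine hcont.continuousAt.eventually (lt_mem_nhds ?_)
    dsimp only
    rw [hgen0]
    exact hu _ ⟨β, β.2, rfl⟩
  obtain ⟨r, hr, hball⟩ := Metric.eventually_nhds_iff.mp hev
  have hpos : ∀ x, ‖x‖ < r → ∀ α ∈ A, u ≤ gen f a φ x α := fun x hx α hα =>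
    (hball (by simpa using hx) ⟨α, hα⟩ (mem_univ _)).le
  have huK : 0 < u + K := by linarith
  obtain ⟨δ, hδ, hst⟩ := hstab (u / (2 * (u + K))) (by positivity) r hr
  obtain ⟨c, hc⟩ := hst 0 (by simpa using hδ.le)
  have hD0 : 0 ≤ D := (norm_nonneg _).trans (hD 0)
  have := aux_prob A f a φ hφ D hD hcont K hK0 hK u r hu0 hr hpos _ (by positivity) 0 c hc
    ((4 * D + 1) / u) (by positivity)
  have e : (4 * D + 1) / u * (u - (u + K) * (u / (2 * (u + K)))) = 2 * D + 1 / 2 := by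
    field_simp
    ring
  linarith
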